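/- With K, F, Q as above, every 3-form φ on ℝ⁶ satisfies K(F(φ)) = −Q(φ)·K(φ). -/

import Mathlib

noncomputable section

/-- The model 6-dimensional real vector space. -/
abbrev V6 := Fin 6 → ℝ

/-- Alternating k-forms on V6. -/
abbrev Form (k : ℕ) := AlternatingMap ℝ V6 ℝ (Fin k)

/-- Wedge product of alternating forms (determinant convention). -/
noncomputable def wedge {a b : ℕ} (φ : Form a) (ψ : Form b) : Form (a + b) :=
  AlternatingMap.domDomCongr finSumFinEquiv
    ((TensorProduct.lid ℝ ℝ).toLinearMap.compAlternatingMap (AlternatingMap.domCoprod φ ψ))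

infixl:70 " ⋏ " => wedge

/-- Interior product (contraction) of a form with a vector. -/
noncomputable def iota (v : V6) {k : ℕ} (φ : Form (k + 1)) : Form k :=
  AlternatingMap.curryLeft φ v

/-- The standard dual basis 1-forms e¹, …, e⁶ (0-indexed). -/
noncomputable def e (i : Fin 6) : Form 1 :=
  AlternatingMap.ofSubsingleton ℝ V6 ℝ 0 (LinearMap.proj i)

/-- The standard basis vectors e₁, …, e₆ (0-indexed). -/
def b (i : Fin 6) : V6 := Pi.single i 1

/-- The standard volume form e¹∧e²∧e³∧e⁴∧e⁵∧e⁶. -/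
noncomputable def vol : Form 6 := e 0 ⋏ e 1 ⋏ e 2 ⋏ e 3 ⋏ e 4 ⋏ e 5

open Equiv Equiv.Perm

/-- If the permutations `r i` represent each coset of block-preserving permutations exactly once,
the wedge product is the signed sum over the `r i`. -/
theorem wedge_apply_eq_sum {p q n : ℕ} (α : Form p) (β : Form q)
    (r : Fin n → Perm (Fin p ⊕ Fin q))
    (hr : ∀ i j, (∀ k, ((r i)⁻¹ (r j (Sum.inl k))).isLeft = true) → i = j)
    (hn : n * (p.factorial * q.factorial) = (p + q).factorial) (v : Fin (p + q) → V6) :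
    (α ⋏ β) v = ∑ i, ((sign (r i) : ℤ) : ℝ) *
      (α (fun k => v (finSumFinEquiv (r i (Sum.inl k)))) *
        β (fun k => v (finSumFinEquiv (r i (Sum.inr k))))) := by
  have hinj : Function.Injective
      (fun i => (Quotient.mk'' (r i) : ModSumCongr (Fin p) (Fin q))) := by
    intro i j hij
    obtain ⟨⟨sl, sr⟩, h⟩ := QuotientGroup.leftRel_apply.mp (Quotient.exact' hij)
    refine hr i j fun k => ?_
    rw [← Perm.mul_apply, ← h]
    simp
  have hcard : Fintype.card (Fin n) = Fintype.card (ModSumCongr (Fin p) (Fin q)) := by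
    have h := (sumCongrHom (Fin p) (Fin q)).range.card_eq_card_quotient_mul_card_subgroup
    rw [← Nat.card_congr (MonoidHom.ofInjective sumCongrHom_injective).toEquiv] at h
    simp only [Nat.card_eq_fintype_card, Fintype.card_perm, Fintype.card_sum, Fintype.card_fin,
      Fintype.card_prod] at h
    rw [Fintype.card_fin]
    refine Nat.eq_of_mul_eq_mul_right (by positivity) (hn.trans h)
  have hbij := (Fintype.bijective_iff_injective_and_card _).mpr ⟨hinj, hcard⟩
  simp only [wedge, AlternatingMap.domDomCongr_apply, LinearMap.compAlternatingMap_apply,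
    AlternatingMap.domCoprod_apply, _root_.sum_apply, map_sum]
  refine (Fintype.sum_bijective _ hbij _ _ fun i => ?_).symm
  rw [AlternatingMap.domCoprod.summand_mk'']
  rcases Int.units_eq_one_or (sign (r i)) with h | h <;>
    simp [h, Function.comp_def]

theorem wedge_two_three_apply (α : Form 2) (β : Form 3) (x : Fin 5 → V6) :
    (α ⋏ β) x =
      α ![x 0, x 1] * β ![x 2, x 3, x 4]
      - α ![x 2, x 1] * β ![x 0, x 3, x 4] - α ![x 3, x 1] * β ![x 2, x 0, x 4]
      - α ![x 4, x 1] * β ![x 2, x 3, x 0] - α ![x 0, x 2] * β ![x 1, x 3, x 4]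
      - α ![x 0, x 3] * β ![x 2, x 1, x 4] - α ![x 0, x 4] * β ![x 2, x 3, x 1]
      + α ![x 2, x 3] * β ![x 0, x 1, x 4] + α ![x 2, x 4] * β ![x 0, x 3, x 1]
      + α ![x 3, x 4] * β ![x 2, x 0, x 1] := by
  let t (i : Fin 2) (j : Fin 3) : Perm (Fin 2 ⊕ Fin 3) := swap (Sum.inl i) (Sum.inr j)
  let r : Fin 10 → Perm (Fin 2 ⊕ Fin 3) :=
    ![1, t 0 0, t 0 1, t 0 2, t 1 0, t 1 1, t 1 2, t 0 0 * t 1 1, t 0 0 * t 1 2, t 0 1 * t 1 2]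
  have hs : ∀ i, (sign (r i) : ℤ) = ![1, -1, -1, -1, -1, -1, -1, 1, 1, 1] i := by decide
  have hl : ∀ i k, finSumFinEquiv (r i (Sum.inl k)) =
    ![![0, 1], ![2, 1], ![3, 1], ![4, 1], ![0, 2], ![0, 3], ![0, 4], ![2, 3], ![2, 4],
      ![3, 4]] i k := by decide
  have hr : ∀ i k, finSumFinEquiv (r i (Sum.inr k)) =
    ![![2, 3, 4], ![0, 3, 4], ![2, 0, 4], ![2, 3, 0], ![1, 3, 4], ![2, 1, 4], ![2, 3, 1],
      ![0, 1, 4], ![0, 3, 1], ![2, 0, 1]] i k := by decide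
  have hα : ∀ i j : Fin 5, (fun k => x ((![i, j] : Fin 2 → Fin 5) k)) = ![x i, x j] := by
    intro i j; ext k : 1; fin_cases k <;> rfl
  have hβ : ∀ i j l : Fin 5, (fun k => x ((![i, j, l] : Fin 3 → Fin 5) k)) =
      ![x i, x j, x l] := by
    intro i j l; ext k : 1; fin_cases k <;> rfl
  rw [wedge_apply_eq_sum α β r (by decide) (by decide)]
  simp only [hs, hl, hr]
  simp [Fin.sum_univ_succ, hα, hβ]
  ring

theorem wedge_three_three_apply (α β : Form 3) (x : Fin 6 → V6) :
    (α ⋏ β) x =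
      α ![x 0, x 1, x 2] * β ![x 3, x 4, x 5]
      - α ![x 3, x 1, x 2] * β ![x 0, x 4, x 5] - α ![x 4, x 1, x 2] * β ![x 3, x 0, x 5]
      - α ![x 5, x 1, x 2] * β ![x 3, x 4, x 0] - α ![x 0, x 3, x 2] * β ![x 1, x 4, x 5]
      - α ![x 0, x 4, x 2] * β ![x 3, x 1, x 5] - α ![x 0, x 5, x 2] * β ![x 3, x 4, x 1]
      - α ![x 0, x 1, x 3] * β ![x 2, x 4, x 5] - α ![x 0, x 1, x 4] * β ![x 3, x 2, x 5]
      - α ![x 0, x 1, x 5] * β ![x 3, x 4, x 2]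
      + α ![x 3, x 4, x 2] * β ![x 0, x 1, x 5] + α ![x 3, x 5, x 2] * β ![x 0, x 4, x 1]
      + α ![x 4, x 5, x 2] * β ![x 3, x 0, x 1] + α ![x 3, x 1, x 4] * β ![x 0, x 2, x 5]
      + α ![x 3, x 1, x 5] * β ![x 0, x 4, x 2] + α ![x 4, x 1, x 5] * β ![x 3, x 0, x 2]
      + α ![x 0, x 3, x 4] * β ![x 1, x 2, x 5] + α ![x 0, x 3, x 5] * β ![x 1, x 4, x 2]
      + α ![x 0, x 4, x 5] * β ![x 3, x 1, x 2]
      - α ![x 3, x 4, x 5] * β ![x 0, x 1, x 2] := by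
  let t (i j : Fin 3) : Perm (Fin 3 ⊕ Fin 3) := swap (Sum.inl i) (Sum.inr j)
  let r : Fin 20 → Perm (Fin 3 ⊕ Fin 3) :=
    ![1, t 0 0, t 0 1, t 0 2, t 1 0, t 1 1, t 1 2, t 2 0, t 2 1, t 2 2,
      t 0 0 * t 1 1, t 0 0 * t 1 2, t 0 1 * t 1 2, t 0 0 * t 2 1, t 0 0 * t 2 2, t 0 1 * t 2 2,
      t 1 0 * t 2 1, t 1 0 * t 2 2, t 1 1 * t 2 2, t 0 0 * t 1 1 * t 2 2]
  have hs : ∀ i, (sign (r i) : ℤ) =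
    ![1, -1, -1, -1, -1, -1, -1, -1, -1, -1, 1, 1, 1, 1, 1, 1, 1, 1, 1, -1] i := by decide
  have hl : ∀ i k, finSumFinEquiv (r i (Sum.inl k)) =
    ![![0, 1, 2], ![3, 1, 2], ![4, 1, 2], ![5, 1, 2], ![0, 3, 2], ![0, 4, 2], ![0, 5, 2],
      ![0, 1, 3], ![0, 1, 4], ![0, 1, 5], ![3, 4, 2], ![3, 5, 2], ![4, 5, 2], ![3, 1, 4],
      ![3, 1, 5], ![4, 1, 5], ![0, 3, 4], ![0, 3, 5], ![0, 4, 5], ![3, 4, 5]] i k := by decide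
  have hr : ∀ i k, finSumFinEquiv (r i (Sum.inr k)) =
    ![![3, 4, 5], ![0, 4, 5], ![3, 0, 5], ![3, 4, 0], ![1, 4, 5], ![3, 1, 5], ![3, 4, 1],
      ![2, 4, 5], ![3, 2, 5], ![3, 4, 2], ![0, 1, 5], ![0, 4, 1], ![3, 0, 1], ![0, 2, 5],
      ![0, 4, 2], ![3, 0, 2], ![1, 2, 5], ![1, 4, 2], ![3, 1, 2], ![0, 1, 2]] i k := by decide
  have hx : ∀ i j l : Fin 6, (fun k => x ((![i, j, l] : Fin 3 → Fin 6) k)) =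
      ![x i, x j, x l] := by
    intro i j l; ext k : 1; fin_cases k <;> rfl
  rw [wedge_apply_eq_sum α β r (by decide) (by decide)]
  simp only [hs, hl, hr]
  simp [Fin.sum_univ_succ, hx]
  ring

theorem wedge_e_apply {p : ℕ} (α : Form p) (c : Fin 6) (v : Fin (p + 1) → V6)
    (h0 : ∀ i : Fin p, v i.castSucc c = 0) (h1 : v (Fin.last p) c = 1) :
    (α ⋏ e c) v = α (fun i => v i.castSucc) := by
  let r : Fin (p + 1) → Perm (Fin p ⊕ Fin 1) :=
    Fin.cases 1 (fun i => swap (Sum.inl i) (Sum.inr 0))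
  have hr : ∀ i j, (∀ k, ((r i)⁻¹ (r j (Sum.inl k))).isLeft = true) → i = j := by
    intro i j h
    induction i using Fin.cases with
    | zero =>
      induction j using Fin.cases with
      | zero => rfl
      | succ j => simpa [r] using h j
    | succ i =>
      by_contra hij
      induction j using Fin.cases with
      | zero => simpa [r] using h i
      | succ j =>
        have hne : i ≠ j := fun h => hij (h ▸ rfl)
        have := h i
        simp [r, swap_apply_of_ne_of_ne, hne] at this
  rw [wedge_apply_eq_sum α (e c) r hr (by simp [Nat.factorial_succ]), Fin.sum_univ_succ]
  have hcast (i : Fin p) : Fin.castAdd 1 i = i.castSucc := rfl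
  have hlast : Fin.natAdd p (0 : Fin 1) = Fin.last p := rfl
  simp [r, e, h0, h1, hcast, hlast]

theorem vol_b : vol b = 1 := by
  unfold vol
  iterate 5
    rw [wedge_e_apply _ _ _ (by intro i; fin_cases i <;> simp [b]) (by simp [b])]
  simp [e, b]

theorem map_update_b (ω : Form 6) (i : Fin 6) (u : V6) :
    ω (Function.update b i u) = ω b * u i := by
  have hu : u = ∑ j, u j • b j := by
    simpa [b] using pi_eq_sum_univ' u
  conv_lhs => rw [hu]
  rw [ω.map_update_sum, Finset.sum_eq_single i]
  · rw [ω.map_update_smul, Function.update_eq_self, smul_eq_mul, mul_comm]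
  · intro j _ hj
    rw [ω.map_update_smul, ω.map_update_self b hj.symm, smul_zero]
  · simp

theorem eq_of_vol_cons_eq {u w : V6}
    (h : ∀ x : Fin 5 → V6, vol (Matrix.vecCons u x) = vol (Matrix.vecCons w x)) : u = w := by
  ext i
  have hcons (z : V6) : Function.update b i z ∘ swap 0 i =
      Matrix.vecCons z (fun k => b (swap 0 i k.succ)) := by
    ext k : 1
    induction k using Fin.cases with
    | zero => simp
    | succ k =>
      have hne : swap 0 i k.succ ≠ i := by
        rw [Ne, swap_apply_eq_iff, swap_apply_right]
        exact Fin.succ_ne_zero k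
      simp [hne]
  have hperm (z : V6) := vol.map_perm (Function.update b i z) (swap 0 i)
  have := (hperm u).symm.trans ((hcons u ▸ hcons w ▸ h _).trans (hperm w))
  rw [smul_left_cancel_iff, map_update_b, map_update_b, vol_b, one_mul, one_mul] at this
  exact this

theorem iota_apply {k : ℕ} (v : V6) (α : Form (k + 1)) (x : Fin k → V6) :
    iota v α x = α (Matrix.vecCons v x) :=
  rfl

theorem iota_smul {k : ℕ} (c : ℝ) (v : V6) (α : Form (k + 1)) :
    iota (c • v) α = c • iota v α :=
  map_smul α.curryLeft c v

theorem map_swap_first (α : Form 3) (x y z : V6) : α ![x, y, z] = -α ![y, x, z] := by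
  rw [← α.map_swap ![y, x, z] (show (0 : Fin 3) ≠ 1 by decide)]
  congr 1; ext k : 1; fin_cases k <;> rfl

theorem map_swap_last (α : Form 3) (x y z : V6) : α ![x, y, z] = -α ![x, z, y] := by
  rw [← α.map_swap ![x, z, y] (show (1 : Fin 3) ≠ 2 by decide)]
  congr 1; ext k : 1; fin_cases k <;> rfl

theorem wedge_three_three_eq_sub (α β : Form 3) (x : Fin 6 → V6) :
    (α ⋏ β) x = (iota (x 0) α ⋏ β) (Matrix.vecTail x) - (iota (x 0) β ⋏ α) (Matrix.vecTail x) := by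
  have h1 (γ : Form 3) {i j : Fin 6} (k : Fin 6) (_ : j < i) :
      γ ![x i, x j, x k] = -γ ![x j, x i, x k] := map_swap_first γ _ _ _
  have h2 (γ : Form 3) (i : Fin 6) {j k : Fin 6} (_ : k < j) :
      γ ![x i, x j, x k] = -γ ![x i, x k, x j] := map_swap_last γ _ _ _
  rw [wedge_three_three_apply, wedge_two_three_apply, wedge_two_three_apply]
  simp [iota_apply, Matrix.vecTail, h1, h2]
  ring

theorem map_eq_map_cons_removeNth (ω : Form 6) (x : Fin 6 → V6) (i : Fin 6) :
    ω x = (-1) ^ (i : ℕ) * ω (Matrix.vecCons (x i) (i.removeNth x)) := by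
  have h := ω.map_perm (Matrix.vecCons (x i) (i.removeNth x)) i.cycleRange
  have hx : Matrix.vecCons (x i) (i.removeNth x) ∘ i.cycleRange = x := by
    ext k : 1
    rcases Fin.eq_self_or_eq_succAbove i k with rfl | ⟨k, rfl⟩
    · simp
    · simp [Fin.removeNth]
  rw [hx, Fin.sign_cycleRange] at h
  rw [h]
  rcases Nat.even_or_odd (i : ℕ) with hi | hi <;> simp [hi.neg_one_pow]

/-- The contractions of a 3-form with itself have vanishing total antisymmetrization. -/
theorem sum_iota_wedge_self (φ : Form 3) (x : Fin 6 → V6) :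
    ∑ i : Fin 6, (-1) ^ (i : ℕ) * (iota (x i) φ ⋏ φ) (i.removeNth x) = 0 := by
  have h1 {i j : Fin 6} (k : Fin 6) (_ : j < i) :
      φ ![x i, x j, x k] = -φ ![x j, x i, x k] := map_swap_first φ _ _ _
  have h2 (i : Fin 6) {j k : Fin 6} (_ : k < j) :
      φ ![x i, x j, x k] = -φ ![x i, x k, x j] := map_swap_last φ _ _ _
  simp only [wedge_two_three_apply, Fin.sum_univ_six, iota_apply, Fin.removeNth]
  simp [Fin.succAbove, Fin.lt_def, h1, h2]
  ring

/-- The endomorphism attached to a 3-form is traceless, expressed through the volume form. -/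
theorem sum_vol_update_eq_zero {φ : Form 3} {K : V6 →ₗ[ℝ] V6}
    (hK : ∀ v : V6, iota (K v) vol = -(iota v φ ⋏ φ)) (x : Fin 6 → V6) :
    ∑ i, vol (Function.update x i (K (x i))) = 0 := by
  rw [← neg_eq_zero, ← Finset.sum_neg_distrib, ← sum_iota_wedge_self φ x]
  refine Finset.sum_congr rfl fun i _ => ?_
  rw [map_eq_map_cons_removeNth vol _ i, Function.update_self, Fin.removeNth_update, ← iota_apply,
    hK, AlternatingMap.neg_apply]
  ring

theorem iota_wedge_add_iota_wedge {φ F : Form 3} {K : V6 →ₗ[ℝ] V6}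
    (hK : ∀ v : V6, iota (K v) vol = -(iota v φ ⋏ φ))
    (hF : ∀ v : V6, iota v F = (-2 : ℝ) • iota (K v) φ) (v : V6) (x : Fin 5 → V6) :
    (iota v φ ⋏ F) x + (iota v F ⋏ φ) x = 0 := by
  have h1 (a b c : V6) : φ ![K a, b, c] = -F ![a, b, c] / 2 := by
    have := congrArg (fun α : Form 2 => α ![b, c]) (hF a)
    simp only [AlternatingMap.smul_apply, iota_apply, smul_eq_mul] at this
    linarith
  have h2 (a b c : V6) : φ ![a, K b, c] = -F ![a, b, c] / 2 := by
    rw [map_swap_first, h1, map_swap_first F b]; ring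
  have h3 (a b c : V6) : φ ![a, b, K c] = -F ![a, b, c] / 2 := by
    rw [map_swap_last, h2, map_swap_last F a c]; ring
  have hvol (w : V6) (y : Fin 5 → V6) :
      vol (Matrix.vecCons (K w) y) = -(iota w φ ⋏ φ) y := by
    rw [← iota_apply, hK, AlternatingMap.neg_apply]
  have h := sum_vol_update_eq_zero hK (Matrix.vecCons (K v) x)
  have hcons (i : Fin 5) (w : V6) : Function.update (Matrix.vecCons (K v) x) i.succ w =
      Matrix.vecCons (K v) (Function.update x i w) := (Fin.cons_update ..).symm
  have hzero (w : V6) : Function.update (Matrix.vecCons (K v) x) 0 w =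
      Matrix.vecCons w x := Fin.update_cons_zero ..
  rw [Fin.sum_univ_succ] at h
  simp only [hcons, hzero, Matrix.cons_val_zero, Matrix.cons_val_succ, hvol,
    wedge_two_three_apply, iota_apply, Fin.sum_univ_five] at h
  simp [h1, h2, h3] at h
  rw [wedge_two_three_apply, wedge_two_three_apply]
  simp only [iota_apply]
  linarith

/-- With K, F, Q as in the paper, every 3-form φ satisfies K(F(φ)) = −Q(φ)·K(φ). -/
theorem K_of_F (φ F : Form 3) (K KF : V6 →ₗ[ℝ] V6) (Q : ℝ)
    (hK : ∀ v : V6, iota (K v) vol = -(iota v φ ⋏ φ))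
    (hF : ∀ v : V6, iota v F = (-2 : ℝ) • iota (K v) φ)
    (hQ : (φ ⋏ F : Form 6) = (-Q) • vol)
    (hKF : ∀ v : V6, iota (KF v) vol = -(iota v F ⋏ F)) :
    KF = (-Q) • K := by
  have hscalar (v : V6) (x : Fin 5 → V6) :
      (iota v φ ⋏ F) x = -Q / 2 * vol (Matrix.vecCons v x) := by
    have hsum := iota_wedge_add_iota_wedge hK hF v x
    have hdiff := wedge_three_three_eq_sub φ F (Matrix.vecCons v x)
    rw [hQ] at hdiff
    simp only [AlternatingMap.smul_apply, smul_eq_mul, Matrix.cons_val_zero,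
      Matrix.tail_cons] at hdiff
    linarith
  have hsmul (v : V6) : iota v F ⋏ F = (-2 : ℝ) • (iota (K v) φ ⋏ F) := by
    ext x
    rw [hF, AlternatingMap.smul_apply, wedge_two_three_apply, wedge_two_three_apply]
    simp only [AlternatingMap.smul_apply, smul_eq_mul]
    ring
  refine LinearMap.ext fun v => eq_of_vol_cons_eq fun x => ?_
  rw [← iota_apply, ← iota_apply, hKF, hsmul, LinearMap.smul_apply, iota_smul,
    AlternatingMap.neg_apply, AlternatingMap.smul_apply, AlternatingMap.smul_apply, hscalar,
    iota_apply, smul_eq_mul, smul_eq_mul]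
  ring
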